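/- arXiv:2304.05458 — 2 statements merged into one kernel-verified Lean document; each statement's English description precedes it below -/
import Mathlib

section
/- Let 1 ≤ r ≤ r' and let T be an r' × r matrix with rational entries. Then for any nonempty subset S ⊆ R^r one has 𝔏(TS) = T 𝔏(S), where TS = {Tv : v ∈ S} ⊆ R^{r'} and T𝔏(S) = {Tv : v ∈ 𝔏(S)}. -/
/-- The set of integer vectors in ℝ^r. -/
def intVecs (r : ℕ) : Set (Fin r → ℝ) :=
  Set.range (fun m : Fin r → ℤ => fun i => (m i : ℝ))

/-- `𝔏(S)`: the identity component (connected component of `0`) of the closure of the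
additive subgroup of ℝ^r generated by `S ∪ ℤ^r`. -/
def Lfrak {r : ℕ} (S : Set (Fin r → ℝ)) : Set (Fin r → ℝ) :=
  connectedComponentIn
    (closure ((AddSubgroup.closure (S ∪ intVecs r) : AddSubgroup (Fin r → ℝ)) :
      Set (Fin r → ℝ))) 0


open Filter Topology

/-- Integer vectors as an additive subgroup. -/
def ZZ (n : ℕ) : AddSubgroup (Fin n → ℝ) where
  carrier := intVecs n
  zero_mem' := ⟨0, by ext; simp⟩
  add_mem' := by
    rintro _ _ ⟨a, rfl⟩ ⟨b, rfl⟩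
    exact ⟨a + b, by ext; simp⟩
  neg_mem' := by
    rintro _ ⟨a, rfl⟩
    exact ⟨-a, by ext; simp⟩

theorem isClosed_ZZ (n : ℕ) : IsClosed (ZZ n : Set (Fin n → ℝ)) := by
  have : (ZZ n : Set (Fin n → ℝ)) = Set.pi Set.univ (fun _ => Set.range ((↑) : ℤ → ℝ)) := by
    ext x
    simp only [Set.mem_pi, Set.mem_univ, true_imp_iff, Set.mem_range]
    constructor
    · rintro ⟨m, rfl⟩ i
      exact ⟨m i, rfl⟩
    · intro h
      choose m hm using h
      exact ⟨m, funext hm⟩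
  rw [this]
  exact isClosed_set_pi fun _ _ => Int.isClosedEmbedding_coe_real.isClosed_range

theorem countable_ZZ (n : ℕ) : (ZZ n : Set (Fin n → ℝ)).Countable :=
  Set.countable_range _

/-- The sum of a subspace and the integer lattice. -/
def LZ {n : ℕ} (L : Submodule ℝ (Fin n → ℝ)) : AddSubgroup (Fin n → ℝ) :=
  L.toAddSubgroup ⊔ ZZ n

theorem mem_LZ {n : ℕ} {L : Submodule ℝ (Fin n → ℝ)} {x : Fin n → ℝ} :
    x ∈ LZ L ↔ ∃ l ∈ L, ∃ z ∈ ZZ n, l + z = x := by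
  simp [LZ, AddSubgroup.mem_sup]

theorem isClosed_LZ {n : ℕ} (A : Set (Fin n → ℝ)) (hA : A ⊆ ZZ n) :
    IsClosed (LZ (Submodule.span ℝ A) : Set (Fin n → ℝ)) := by
  obtain ⟨s, hs, hsp⟩ := (Submodule.fg_span_iff_fg_span_finset_subset A).1
    (IsNoetherian.noetherian (Submodule.span ℝ A))
  let f : (s → ℝ) → (Fin n → ℝ) := fun c => ∑ a, c a • (a : Fin n → ℝ)
  have hf : Continuous f := by fun_prop
  have hC : IsCompact (f '' Set.pi Set.univ (fun _ => Set.Icc (0:ℝ) 1)) :=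
    (isCompact_univ_pi fun _ => isCompact_Icc).image hf
  have key := (isClosed_ZZ n).add_left_of_isCompact hC
  convert key using 1
  ext x
  rw [SetLike.mem_coe, mem_LZ, Set.mem_add]
  constructor
  · rintro ⟨l, hl, z, hz, rfl⟩
    rw [hsp, Submodule.mem_span_finset'] at hl
    obtain ⟨c, rfl⟩ := hl
    refine ⟨f (fun a => Int.fract (c a)), ⟨_, ?_, rfl⟩,
      (∑ a : s, (⌊c a⌋ : ℤ) • (a : Fin n → ℝ)) + z, ?_, ?_⟩
    · intro a _
      exact ⟨Int.fract_nonneg _, (Int.fract_lt_one _).le⟩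
    · exact add_mem (sum_mem fun a _ => zsmul_mem (hA (hs a.2)) _) hz
    · rw [← add_assoc, ← Finset.sum_add_distrib]
      congr 1
      refine Finset.sum_congr rfl fun a _ => ?_
      rw [← Int.cast_smul_eq_zsmul ℝ, ← add_smul, Int.fract_add_floor]
  · rintro ⟨_, ⟨c, -, rfl⟩, z, hz, rfl⟩
    refine ⟨_, ?_, z, hz, rfl⟩
    exact sum_mem fun a _ => Submodule.smul_mem _ _ (Submodule.subset_span (hs a.2))

theorem exists_proj {n : ℕ} (L : Submodule ℝ (Fin n → ℝ)) :
    ∃ p : (Fin n → ℝ) →ₗ[ℝ] (Fin n → ℝ), (∀ x, p x = 0 ↔ x ∈ L) ∧ (∀ x, x - p x ∈ L) := by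
  obtain ⟨g, hg⟩ := L.mkQ.exists_rightInverse_of_surjective (Submodule.range_mkQ L)
  have h : ∀ y, L.mkQ (g y) = y := fun y => LinearMap.congr_fun hg y
  have h2 : ∀ x, x - g (L.mkQ x) ∈ L := by
    intro x
    rw [← Submodule.Quotient.mk_eq_zero, ← Submodule.mkQ_apply, map_sub, h, sub_self]
  refine ⟨g ∘ₗ L.mkQ, fun x => ⟨fun hx => ?_, fun hx => ?_⟩, h2⟩
  · have := h2 x
    rw [LinearMap.comp_apply] at hx
    rwa [hx, sub_zero] at this
  · rw [LinearMap.comp_apply, (by simpa using hx : L.mkQ x = 0), map_zero]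

/-- The closed subgroup whose identity component is `Lfrak`. -/
def GG {n : ℕ} (S : Set (Fin n → ℝ)) : AddSubgroup (Fin n → ℝ) :=
  (AddSubgroup.closure (S ∪ intVecs n)).topologicalClosure

theorem Lfrak_eq {n : ℕ} (S : Set (Fin n → ℝ)) :
    Lfrak S = connectedComponentIn (GG S : Set (Fin n → ℝ)) 0 := rfl

theorem isClosed_GG {n : ℕ} (S : Set (Fin n → ℝ)) : IsClosed (GG S : Set (Fin n → ℝ)) :=
  AddSubgroup.isClosed_topologicalClosure _

theorem subset_GG {n : ℕ} (S : Set (Fin n → ℝ)) : S ⊆ GG S := fun _ hx =>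
  AddSubgroup.le_topologicalClosure _ (AddSubgroup.subset_closure (Or.inl hx))

theorem ZZ_le_GG {n : ℕ} (S : Set (Fin n → ℝ)) : ZZ n ≤ GG S := fun _ hx =>
  AddSubgroup.le_topologicalClosure _ (AddSubgroup.subset_closure (Or.inr hx))

theorem GG_le {n : ℕ} (S : Set (Fin n → ℝ)) (P : AddSubgroup (Fin n → ℝ))
    (hP : IsClosed (P : Set (Fin n → ℝ))) (hS : S ⊆ P) (hZ : ZZ n ≤ P) : GG S ≤ P :=
  AddSubgroup.topologicalClosure_minimal _
    ((AddSubgroup.closure_le _).2 (Set.union_subset hS hZ)) hP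

theorem Lfrak_subset {n : ℕ} (S : Set (Fin n → ℝ)) (A : Set (Fin n → ℝ)) (hA : A ⊆ ZZ n)
    (K : ℕ) (hK : 0 < K) (hS : ∀ s ∈ S, K • s ∈ LZ (Submodule.span ℝ A)) :
    Lfrak S ⊆ Submodule.span ℝ A := by
  set L := Submodule.span ℝ A with hL
  obtain ⟨p, hp, -⟩ := exists_proj L
  have hpc : Continuous p := p.continuous_of_finiteDimensional
  have hG : GG S ≤ (LZ L).comap (nsmulAddMonoidHom K) := by
    apply GG_le
    · exact (isClosed_LZ A hA).preimage (continuous_const_smul K)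
    · exact hS
    · intro z hz
      exact (le_sup_right : ZZ n ≤ LZ L) (nsmul_mem hz K)
  have hpre : IsPreconnected ((fun x => K • p x) '' Lfrak S) :=
    isPreconnected_connectedComponentIn.image _ (by fun_prop)
  have hsub : ((fun x => K • p x) '' Lfrak S) ⊆ p '' (ZZ n : Set (Fin n → ℝ)) := by
    rintro _ ⟨x, hx, rfl⟩
    have hx' : K • x ∈ LZ L := hG (connectedComponentIn_subset _ _ hx)
    obtain ⟨l, hl, z, hz, h⟩ := mem_LZ.1 hx'
    refine ⟨z, hz, ?_⟩
    dsimp only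
    rw [← map_nsmul, ← h, map_add, (hp l).2 hl, zero_add]
  have hss := ((countable_ZZ n).image p).isTotallyDisconnected _ hsub hpre
  intro x hx
  have h0 : (0 : Fin n → ℝ) ∈ Lfrak S := mem_connectedComponentIn (GG S).zero_mem
  have := hss ⟨x, hx, rfl⟩ ⟨0, h0, rfl⟩
  simp only [map_zero, smul_zero] at this
  exact (hp x).1 ((smul_eq_zero.1 this).resolve_left hK.ne')

/-- The largest subspace contained in an additive subgroup. -/
def maxSub {n : ℕ} (G : AddSubgroup (Fin n → ℝ)) : Submodule ℝ (Fin n → ℝ) where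
  carrier := {v | ∀ t : ℝ, t • v ∈ G}
  zero_mem' := fun t => by simp
  add_mem' := fun {a b} ha hb t => by rw [smul_add]; exact add_mem (ha t) (hb t)
  smul_mem' := fun c x hx t => by rw [smul_smul]; exact hx _

theorem maxSub_le {n : ℕ} (G : AddSubgroup (Fin n → ℝ)) {v : Fin n → ℝ} (hv : v ∈ maxSub G) :
    v ∈ G := by simpa using hv 1

theorem local_maxSub {n : ℕ} (G : AddSubgroup (Fin n → ℝ)) (hG : IsClosed (G : Set (Fin n → ℝ))) :
    ∃ ε > 0, ∀ g ∈ G, ‖g‖ < ε → g ∈ maxSub G := by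
  obtain ⟨p, hp, hp2⟩ := exists_proj (maxSub G)
  have hpc : Continuous p := p.continuous_of_finiteDimensional
  have hpG : ∀ g ∈ G, p g ∈ G := fun g hg => by
    have := sub_mem hg (maxSub_le G (hp2 g))
    simpa using this
  have hpp : ∀ g, p (p g) = p g := fun g => by
    have := (hp _).2 (hp2 g)
    rw [map_sub, sub_eq_zero] at this
    exact this.symm
  -- there is a ball in which the projected group is trivial
  have main : ∃ δ > 0, ∀ w ∈ G, p w = w → ‖w‖ < δ → w = 0 := by
    by_contra! hcon
    choose w hwG hpw hwlt hw0 using fun k : ℕ => hcon (1 / ((k : ℝ) + 1)) (by positivity)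
    have hwn : ∀ k, 0 < ‖w k‖ := fun k => norm_pos_iff.2 (hw0 k)
    have hw_lim : Tendsto (fun k => ‖w k‖) atTop (𝓝 0) :=
      squeeze_zero (fun _ => norm_nonneg _) (fun k => (hwlt k).le)
        tendsto_one_div_add_atTop_nhds_zero_nat
    let u : ℕ → (Fin n → ℝ) := fun k => ‖w k‖⁻¹ • w k
    have hu : ∀ k, u k ∈ Metric.sphere (0 : Fin n → ℝ) 1 := fun k => by
      simp [u, norm_smul, (hwn k).ne']
    obtain ⟨v, hv, φ, hφ, hlim⟩ := (isCompact_sphere (0 : Fin n → ℝ) 1).tendsto_subseq hu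
    have hpv : p v = v := by
      refine tendsto_nhds_unique ((hpc.tendsto v).comp hlim) ?_
      convert hlim using 1
      ext1 k
      simp [u, hpw]
    have hvV : v ∈ maxSub G := by
      intro t
      let y : ℕ → (Fin n → ℝ) := fun k => (⌊t / ‖w (φ k)‖⌋ : ℤ) • w (φ k)
      have hyG : ∀ k, y k ∈ (G : Set (Fin n → ℝ)) := fun k => zsmul_mem (hwG _) _
      have hd : Tendsto (fun k => t • u (φ k) - y k) atTop (𝓝 0) := by
        refine squeeze_zero_norm (fun k => ?_) (hw_lim.comp hφ.tendsto_atTop)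
        have : t • u (φ k) - y k = Int.fract (t / ‖w (φ k)‖) • w (φ k) := by
          simp only [u, y]
          rw [← Int.cast_smul_eq_zsmul ℝ, smul_smul, ← sub_smul, Int.fract, div_eq_mul_inv]
        rw [this, norm_smul, Real.norm_of_nonneg (Int.fract_nonneg _)]
        exact mul_le_of_le_one_left (norm_nonneg _) (Int.fract_lt_one _).le
      have hy : Tendsto y atTop (𝓝 (t • v)) := by
        have := (hlim.const_smul t).sub hd
        simpa using this
      exact hG.mem_of_tendsto hy (Eventually.of_forall hyG)
    have : v = 0 := by rw [← hpv]; exact (hp v).2 hvV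
    simp [this] at hv
  obtain ⟨δ, hδ, h⟩ := main
  have hcont : Tendsto (fun x => ‖p x‖) (𝓝 0) (𝓝 0) := by
    have : Continuous fun x => ‖p x‖ := by fun_prop
    simpa using this.tendsto 0
  obtain ⟨ε, hε, hball⟩ := Metric.eventually_nhds_iff_ball.1 (hcont.eventually (gt_mem_nhds hδ))
  refine ⟨ε, hε, fun g hg hgε => (hp g).1 ?_⟩
  exact h _ (hpG g hg) (hpp g) (hball g (by simpa using hgε))

/-- Dirichlet-type approximation. -/
theorem dirichlet {n : ℕ} (v : Fin n → ℝ) (ε : ℝ) (hε : 0 < ε) :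
    ∃ q : ℕ, 0 < q ∧ ∃ z ∈ ZZ n, ‖q • v - z‖ < ε := by
  let z : ℕ → (Fin n → ℝ) := fun t i => (⌊t * v i⌋ : ℤ)
  have hz : ∀ t, z t ∈ ZZ n := fun t => ⟨fun i => ⌊t * v i⌋, rfl⟩
  let f : ℕ → (Fin n → ℝ) := fun t => t • v - z t
  have hf : ∀ t, f t ∈ Set.pi Set.univ (fun _ : Fin n => Set.Icc (0:ℝ) 1) := by
    intro t i _
    have : f t i = Int.fract (t * v i) := by simp [f, z]
    rw [this]
    exact ⟨Int.fract_nonneg _, (Int.fract_lt_one _).le⟩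
  obtain ⟨a, -, φ, hφ, hlim⟩ :=
    (isCompact_univ_pi fun _ : Fin n => isCompact_Icc (a := (0:ℝ)) (b := 1)).tendsto_subseq hf
  obtain ⟨N, hN⟩ := Metric.cauchySeq_iff'.1 hlim.cauchySeq ε hε
  have h1 := hN (N + 1) (Nat.le_succ N)
  have hlt : φ N < φ (N + 1) := hφ (Nat.lt_succ_self N)
  refine ⟨φ (N + 1) - φ N, Nat.sub_pos_of_lt hlt, z (φ (N+1)) - z (φ N), sub_mem (hz _) (hz _), ?_⟩
  rw [dist_eq_norm] at h1
  have heq : (φ (N + 1) - φ N) • v - (z (φ (N+1)) - z (φ N)) = f (φ (N + 1)) - f (φ N) := by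
    simp only [f]
    rw [sub_nsmul _ hlt.le]
    abel
  rw [heq]
  exact h1

theorem structure_thm {n : ℕ} (S : Set (Fin n → ℝ)) :
    ∃ A : Set (Fin n → ℝ), A ⊆ ZZ n ∧ Lfrak S = Submodule.span ℝ A ∧
      ∃ M : ℕ, 0 < M ∧ ∀ s ∈ S, M • s ∈ LZ (Submodule.span ℝ A) := by
  set G := GG S with hGdef
  set V := maxSub G with hV
  have hVG : ∀ v ∈ V, v ∈ G := fun v hv => maxSub_le G hv
  obtain ⟨ε, hε, hloc⟩ := local_maxSub G (isClosed_GG S)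
  have hZG : ZZ n ≤ G := ZZ_le_GG S
  let A : Set (Fin n → ℝ) := {z | z ∈ ZZ n ∧ z ∈ V}
  have hAV : Submodule.span ℝ A = V := by
    apply le_antisymm
    · exact Submodule.span_le.2 fun z hz => hz.2
    · intro v hv
      have hcl : IsClosed (Submodule.span ℝ A : Set (Fin n → ℝ)) :=
        Submodule.closed_of_finiteDimensional _
      rw [← SetLike.mem_coe, ← hcl.closure_eq, Metric.mem_closure_iff]
      intro η hη
      obtain ⟨q, hq, z, hz, hlt⟩ := dirichlet v (min ε η) (lt_min hε hη)
      have hqv : q • v ∈ V := nsmul_mem hv q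
      have h1 : q • v - z ∈ V :=
        hloc _ (sub_mem (hVG _ hqv) (hZG hz)) (hlt.trans_le (min_le_left _ _))
      have hzV : z ∈ V := by simpa using sub_mem hqv h1
      have hq' : (1:ℝ) ≤ q := by exact_mod_cast hq
      refine ⟨(q:ℝ)⁻¹ • z, Submodule.smul_mem _ _ (Submodule.subset_span ⟨hz, hzV⟩), ?_⟩
      have : v - (q:ℝ)⁻¹ • z = (q:ℝ)⁻¹ • (q • v - z) := by
        rw [← Nat.cast_smul_eq_nsmul ℝ, smul_sub, smul_smul, inv_mul_cancel₀ (by positivity),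
          one_smul]
      rw [dist_eq_norm, this, norm_smul, norm_inv, Real.norm_of_nonneg (by positivity)]
      calc (q:ℝ)⁻¹ * ‖q • v - z‖ ≤ 1 * ‖q • v - z‖ := by
            gcongr
            exact inv_le_one_of_one_le₀ hq'
        _ < η := by rw [one_mul]; exact hlt.trans_le (min_le_right _ _)
  -- uniform torsion
  have hM : ∃ M : ℕ, 0 < M ∧ ∀ s ∈ S, M • s ∈ LZ V := by
    have hcomp : ∃ M : ℕ, 0 < M ∧
        ∀ g ∈ Set.pi Set.univ (fun _ : Fin n => Set.Icc (0:ℝ) 1), g ∈ G → M • g ∈ LZ V := by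
      refine (isCompact_univ_pi fun _ : Fin n => isCompact_Icc (a := (0:ℝ)) (b := 1)).induction_on
        (p := fun s => ∃ M : ℕ, 0 < M ∧ ∀ g ∈ s, g ∈ G → M • g ∈ LZ V) ?_ ?_ ?_ ?_
      · exact ⟨1, one_pos, fun g hg => hg.elim⟩
      · rintro s t hst ⟨M, hM, h⟩
        exact ⟨M, hM, fun g hg => h g (hst hg)⟩
      · rintro s t ⟨M, hM, h⟩ ⟨M', hM', h'⟩
        refine ⟨M * M', Nat.mul_pos hM hM', ?_⟩
        rintro g (hg | hg) hgG
        · rw [mul_comm, mul_smul]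
          exact nsmul_mem (h g hg hgG) _
        · rw [mul_smul]
          exact nsmul_mem (h' g hg hgG) _
      · intro x _
        refine ⟨Metric.ball x (ε / 2), mem_nhdsWithin_of_mem_nhds (Metric.ball_mem_nhds x (by positivity)), ?_⟩
        by_cases hex : ∃ g₀ ∈ Metric.ball x (ε / 2), g₀ ∈ G
        · obtain ⟨g₀, hg₀, hg₀G⟩ := hex
          obtain ⟨q, hq, z, hz, hlt⟩ := dirichlet g₀ ε hε
          have h1 : q • g₀ - z ∈ V := hloc _ (sub_mem (nsmul_mem hg₀G q) (hZG hz)) hlt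
          refine ⟨q, hq, fun g hg hgG => ?_⟩
          have h2 : g - g₀ ∈ V := by
            refine hloc _ (sub_mem hgG hg₀G) ?_
            rw [← dist_eq_norm]
            have := dist_triangle_right g g₀ x
            rw [Metric.mem_ball] at hg hg₀
            linarith
          refine mem_LZ.2 ⟨q • (g - g₀) + (q • g₀ - z), add_mem (nsmul_mem h2 q) h1, z, hz, ?_⟩
          rw [smul_sub]
          abel
        · exact ⟨1, one_pos, fun g hg hgG => (hex ⟨g, hg, hgG⟩).elim⟩
    obtain ⟨M, hM, h⟩ := hcomp
    refine ⟨M, hM, fun s hs => ?_⟩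
    let z : Fin n → ℝ := fun i => (⌊s i⌋ : ℤ)
    have hz : z ∈ ZZ n := ⟨fun i => ⌊s i⌋, rfl⟩
    have h1 : M • (s - z) ∈ LZ V := by
      refine h _ (fun i _ => ?_) (sub_mem (subset_GG S hs) (hZG hz))
      have : (s - z) i = Int.fract (s i) := by simp [z]
      rw [this]
      exact ⟨Int.fract_nonneg _, (Int.fract_lt_one _).le⟩
    have h2 : M • z ∈ LZ V := (le_sup_right : ZZ n ≤ LZ V) (nsmul_mem hz M)
    have := add_mem h1 h2
    rwa [← smul_add, sub_add_cancel] at this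
  obtain ⟨M, hM0, hMs⟩ := hM
  have hMs' : ∀ s ∈ S, M • s ∈ LZ (Submodule.span ℝ A) := by rw [hAV]; exact hMs
  refine ⟨A, fun z hz => hz.1, ?_, M, hM0, hMs'⟩
  apply Set.Subset.antisymm
  · exact Lfrak_subset S A (fun z hz => hz.1) M hM0 hMs'
  · rw [hAV, Lfrak_eq]
    exact (V.convex.isPreconnected).subset_connectedComponentIn V.zero_mem hVG

theorem exists_denom {r r' : ℕ} (T : Matrix (Fin r') (Fin r) ℝ)
    (hT : ∀ i j, ∃ q : ℚ, T i j = (q : ℝ)) :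
    ∃ N : ℕ, 0 < N ∧ ∀ z ∈ ZZ r, N • T.mulVec z ∈ ZZ r' := by
  choose q hq using hT
  let N : ℕ := ∏ i, ∏ j, (q i j).den
  have hint : ∀ i j, ∃ m : ℤ, (N : ℝ) * T i j = m := by
    intro i j
    have hd : (q i j).den ∣ N :=
      (Finset.dvd_prod_of_mem (fun j => (q i j).den) (Finset.mem_univ j)).trans
        (Finset.dvd_prod_of_mem (fun i => ∏ j, (q i j).den) (Finset.mem_univ i))
    obtain ⟨c, hc⟩ := hd
    refine ⟨c * (q i j).num, ?_⟩
    have h1 : (q i j) * ((q i j).den : ℚ) = (q i j).num := Rat.mul_den_eq_num _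
    have h2 : ((q i j : ℚ) : ℝ) * ((q i j).den : ℝ) = ((q i j).num : ℝ) := by exact_mod_cast h1
    rw [hq, hc]
    push_cast
    rw [← h2]
    ring
  choose m hm using hint
  refine ⟨N, Finset.prod_pos fun i _ => Finset.prod_pos fun j _ => (q i j).den_pos, ?_⟩
  rintro _ ⟨z, rfl⟩
  refine ⟨fun i => ∑ j, m i j * z j, ?_⟩
  ext i
  simp only [Pi.smul_apply, Matrix.mulVec, dotProduct, nsmul_eq_mul, Finset.mul_sum, Int.cast_sum,
    Int.cast_mul, ← hm, mul_assoc]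

/-- For a rational matrix `T` (of size r' × r, with 1 ≤ r ≤ r') and nonempty `S ⊆ ℝ^r`,
one has `𝔏(T S) = T 𝔏(S)`. -/
theorem Lfrak_image_rational_matrix (r r' : ℕ) (hr : 1 ≤ r) (hrr' : r ≤ r')
    (T : Matrix (Fin r') (Fin r) ℝ) (hT : ∀ i j, ∃ q : ℚ, T i j = (q : ℝ))
    (S : Set (Fin r → ℝ)) (hS : S.Nonempty) :
    Lfrak (T.mulVec '' S) = T.mulVec '' Lfrak S := by
  obtain ⟨N, hN, hNT⟩ := exists_denom T hT
  obtain ⟨A, hA, hLA, M, hM, hMS⟩ := structure_thm S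
  have hN' : (N : ℝ) ≠ 0 := by exact_mod_cast hN.ne'
  have hlin : ∀ x, T.mulVec x = T.mulVecLin x := fun _ => rfl
  let F : (Fin r → ℝ) →ₗ[ℝ] (Fin r' → ℝ) := (N : ℝ) • T.mulVecLin
  have hF : ∀ x, F x = N • T.mulVec x := fun x => by
    simp [F, Nat.cast_smul_eq_nsmul]
  have hFc : Continuous F := F.continuous_of_finiteDimensional
  have himg : T.mulVec '' Lfrak S = F '' Lfrak S := by
    rw [hLA]
    ext y
    constructor
    · rintro ⟨x, hx, rfl⟩
      refine ⟨(N:ℝ)⁻¹ • x, Submodule.smul_mem _ _ hx, ?_⟩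
      simp [F, smul_smul, hN', Matrix.mulVec_smul]
    · rintro ⟨x, hx, rfl⟩
      refine ⟨(N:ℝ) • x, Submodule.smul_mem _ _ hx, ?_⟩
      simp [F, Matrix.mulVec_smul]
  rw [himg]
  apply Set.Subset.antisymm
  · have hspan : F '' Lfrak S = Submodule.span ℝ (F '' A) := by
      rw [hLA, ← Submodule.map_span, Submodule.map_coe]
    rw [hspan]
    refine Lfrak_subset _ _ ?_ (N * M) (Nat.mul_pos hN hM) ?_
    · rintro _ ⟨a, ha, rfl⟩
      rw [hF]
      exact hNT a (hA ha)
    · rintro _ ⟨s, hs, rfl⟩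
      obtain ⟨l, hl, z, hz, h⟩ := mem_LZ.1 (hMS s hs)
      have : (N * M) • T.mulVec s = F l + F z := by
        rw [← map_add, h, map_nsmul, hF, smul_smul, mul_comm]
      rw [this]
      refine mem_LZ.2 ⟨F l, ?_, F z, ?_, rfl⟩
      · rw [← Submodule.map_span]
        exact Submodule.mem_map_of_mem hl
      · rw [hF]
        exact hNT z hz
  · rw [Lfrak_eq (T.mulVec '' S)]
    have hle : GG S ≤ (GG (T.mulVec '' S)).comap F.toAddMonoidHom := by
      apply GG_le
      · exact (isClosed_GG _).preimage hFc
      · intro s hs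
        change F s ∈ GG _
        rw [hF]
        exact nsmul_mem (subset_GG (T.mulVec '' S) (Set.mem_image_of_mem _ hs)) N
      · intro z hz
        change F z ∈ GG _
        rw [hF]
        exact ZZ_le_GG _ (hNT z hz)
    refine (isPreconnected_connectedComponentIn.image F hFc.continuousOn).subset_connectedComponentIn
      ⟨0, mem_connectedComponentIn (GG S).zero_mem, map_zero F⟩ ?_
    rintro _ ⟨x, hx, rfl⟩
    exact hle (connectedComponentIn_subset _ _ hx)
end

section
/- For any vector u = (u_1,...,u_r) ∈ R_{>0}^r, there exist positive integers q_1,...,q_r such that the vector (q_1 u_1, ..., q_r u_r) is admissible. -/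
/-- The coordinatewise inverse `ũ` of a vector `u`. -/
noncomputable def tildeVec {r : ℕ} (u : Fin r → ℝ) : Fin r → ℝ := fun i => (u i)⁻¹

/-- A vector `u ∈ ℝ_{>0}^r` is admissible if `u_i ũ ∈ 𝔏({u_i ũ}) + ℤ^r` for every `i`. -/
def AdmissibleVec {r : ℕ} (u : Fin r → ℝ) : Prop :=
  ∀ i : Fin r, ∃ w ∈ Lfrak {u i • tildeVec u}, ∃ m ∈ intVecs r,
    u i • tildeVec u = w + m

open Filter Topology in
lemma aux_line {E : Type*} [NormedAddCommGroup E] [NormedSpace ℝ E] (G : AddSubgroup E)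
    (hG : IsClosed (G : Set E)) (g : ℕ → E) (w : E) (hg : ∀ n, g n ∈ G)
    (hg0 : ∀ n, g n ≠ 0) (hlim : Tendsto (fun n => ‖g n‖) atTop (𝓝 0))
    (hw : Tendsto (fun n => ‖g n‖⁻¹ • g n) atTop (𝓝 w)) (t : ℝ) : t • w ∈ G := by
  have h1 : Tendsto (fun n => (⌊t / ‖g n‖⌋ : ℝ) * ‖g n‖) atTop (𝓝 t) := by
    rw [tendsto_iff_dist_tendsto_zero]
    refine squeeze_zero (fun _ => dist_nonneg) (fun n => ?_) hlim
    have hp : 0 < ‖g n‖ := norm_pos_iff.mpr (hg0 n)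
    have e : t = t / ‖g n‖ * ‖g n‖ := by field_simp
    have a1 := Int.floor_le (t / ‖g n‖)
    have a2 := Int.lt_floor_add_one (t / ‖g n‖)
    rw [Real.dist_eq, abs_le]
    constructor <;> nlinarith
  have h2 := h1.smul hw
  refine hG.mem_of_tendsto h2 (Eventually.of_forall fun n => ?_)
  have hp : ‖g n‖ ≠ 0 := norm_ne_zero_iff.mpr (hg0 n)
  have : ((⌊t / ‖g n‖⌋ : ℝ) * ‖g n‖) • ‖g n‖⁻¹ • g n = ⌊t / ‖g n‖⌋ • g n := by
    rw [smul_smul, mul_assoc, mul_inv_cancel₀ hp, mul_one, Int.cast_smul_eq_zsmul]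
  simp only [this]
  exact G.zsmul_mem (hg n) _

/-- the largest linear subspace in an additive subgroup -/
def linPart {E : Type*} [AddCommGroup E] [Module ℝ E] (G : AddSubgroup E) : Submodule ℝ E where
  carrier := {v | ∀ t : ℝ, t • v ∈ G}
  add_mem' := fun ha hb t => by rw [smul_add]; exact G.add_mem (ha t) (hb t)
  zero_mem' := fun t => by rw [smul_zero]; exact G.zero_mem
  smul_mem' := fun c v hv t => by rw [smul_smul]; exact hv _

lemma linPart_le {E : Type*} [AddCommGroup E] [Module ℝ E] (G : AddSubgroup E) {v : E}
    (hv : v ∈ linPart G) : v ∈ G := by simpa using hv 1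

open Filter Topology in
lemma aux_discrete {E : Type*} [NormedAddCommGroup E] [NormedSpace ℝ E] [FiniteDimensional ℝ E]
    (G : AddSubgroup E) (hG : IsClosed (G : Set E)) (W : Submodule ℝ E)
    (hW : Disjoint (linPart G) W) :
    ∃ ε > 0, ∀ g ∈ G, g ∈ W → ‖g‖ < ε → g = 0 := by
  by_contra! hcon
  have : ∀ n : ℕ, ∃ g ∈ G, g ∈ W ∧ ‖g‖ < 1 / ((n : ℝ) + 1) ∧ g ≠ 0 := fun n =>
    hcon _ (by positivity)
  choose g hgG hgW hgn hg0 using this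
  have hlim : Tendsto (fun n => ‖g n‖) atTop (𝓝 0) :=
    squeeze_zero (fun _ => norm_nonneg _) (fun n => (hgn n).le) tendsto_one_div_add_atTop_nhds_zero_nat
  have hs : ∀ n, ‖g n‖⁻¹ • g n ∈ Metric.sphere (0 : E) 1 := fun n => by
    simp [norm_smul, inv_mul_cancel₀ (norm_ne_zero_iff.mpr (hg0 n))]
  have : ProperSpace E := FiniteDimensional.proper ℝ E
  obtain ⟨w, hw, φ, hφ, hφl⟩ := (isCompact_sphere (0 : E) 1).tendsto_subseq hs
  have hV : w ∈ linPart G := fun t =>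
    aux_line G hG (g ∘ φ) w (fun n => hgG _) (fun n => hg0 _) (hlim.comp hφ.tendsto_atTop) hφl t
  have hWw : w ∈ W := by
    refine (Submodule.closed_of_finiteDimensional W).mem_of_tendsto hφl
      (Eventually.of_forall fun n => ?_)
    exact W.smul_mem _ (hgW _)
  have : w = 0 := by simpa using hW.le_bot ⟨hV, hWw⟩
  simp [this] at hw

lemma aux_int_span {r : ℕ} {y : Fin r → ℝ} :
    y ∈ Submodule.span ℤ (Set.range (Pi.basisFun ℝ (Fin r))) ↔ y ∈ intVecs r := by
  rw [Module.Basis.mem_span_iff_repr_mem]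
  constructor
  · intro h
    choose m hm using h
    exact ⟨m, funext fun i => by simpa using hm i⟩
  · rintro ⟨m, rfl⟩ i
    exact ⟨m i, by simp⟩

lemma aux_main {r : ℕ} (x : Fin r → ℝ)
    (hx : ∀ m : Fin r → ℤ, (∃ N : ℤ, N ≠ 0 ∧ ∃ k : ℤ, (N : ℝ) * ∑ i, (m i : ℝ) * x i = k) →
      ∃ k : ℤ, ∑ i, (m i : ℝ) * x i = k) :
    ∃ w ∈ Lfrak {x}, ∃ m ∈ intVecs r, x = w + m := by
  set G : AddSubgroup (Fin r → ℝ) := (AddSubgroup.closure ({x} ∪ intVecs r)).topologicalClosure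
    with hGdef
  have hG : IsClosed (G : Set (Fin r → ℝ)) := AddSubgroup.isClosed_topologicalClosure _
  have hsub : ({x} ∪ intVecs r) ⊆ (G : Set (Fin r → ℝ)) :=
    AddSubgroup.subset_closure.trans (AddSubgroup.le_topologicalClosure _)
  have hxG : x ∈ G := hsub (Or.inl rfl)
  obtain ⟨W, hc⟩ := Submodule.exists_isCompl (linPart G)
  obtain ⟨ε, hε, hdisc⟩ := aux_discrete G hG W hc.disjoint
  let π := W.projectionOnto (linPart G) hc.symm
  have hπV : ∀ y, y - (π y : Fin r → ℝ) ∈ linPart G := by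
    intro y
    rw [← Submodule.projectionOnto_apply_eq_zero_iff hc.symm, map_sub,
      Submodule.projectionOnto_apply_left hc.symm (π y)]
    exact sub_self _
  have hπG : ∀ y ∈ G, (π y : Fin r → ℝ) ∈ G := by
    intro y hy
    have := G.sub_mem hy (linPart_le G (hπV y))
    simpa using this
  let Λ : Submodule ℤ W := AddSubgroup.toIntSubmodule (G.comap W.subtype.toAddMonoidHom)
  have hΛ : ∀ y : W, y ∈ Λ ↔ (y : Fin r → ℝ) ∈ G := fun y => Iff.rfl
  have dΛ : DiscreteTopology Λ := by
    refine discreteTopology_iff_isOpen_singleton_zero.mpr ⟨Metric.ball 0 ε, Metric.isOpen_ball, ?_⟩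
    ext y
    simp only [Set.mem_preimage, Metric.mem_ball, dist_zero_right, Set.mem_singleton_iff]
    constructor
    · intro h
      have := hdisc _ ((hΛ _).mp y.2) y.1.2 h
      ext1; ext1; exact this
    · rintro rfl; simpa using hε
  let Λ₀ : Submodule ℤ W :=
    (Submodule.span ℤ (Set.range (Pi.basisFun ℝ (Fin r)))).map (π.restrictScalars ℤ)
  have hle : Λ₀ ≤ Λ := by
    rintro _ ⟨y, hy, rfl⟩
    exact (hΛ _).mpr (hπG _ (hsub (Or.inr (aux_int_span.mp hy))))
  have d0 : DiscreteTopology Λ₀ := DiscreteTopology.of_subset dΛ hle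
  have z0 : IsZLattice ℝ Λ₀ := ⟨by
    rw [eq_top_iff]
    intro y _
    have hy : π (y : Fin r → ℝ) = y := Submodule.projectionOnto_apply_left hc.symm y
    rw [← hy, ← (Pi.basisFun ℝ (Fin r)).sum_repr (y : Fin r → ℝ), map_sum]
    refine Submodule.sum_mem _ fun i _ => ?_
    rw [map_smul]
    refine Submodule.smul_mem _ _ (Submodule.subset_span ⟨_, Submodule.subset_span ⟨i, rfl⟩, rfl⟩)⟩
  let b := Module.Free.chooseBasis ℤ Λ₀
  let B := b.ofZLatticeBasis ℝ Λ₀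
  have hB : Submodule.span ℤ (Set.range B) = Λ₀ := b.ofZLatticeBasis_span ℝ Λ₀
  -- rationality
  have hrat : ∃ N : ℤ, N ≠ 0 ∧ N • π x ∈ Λ₀ := by
    have hfin : ((ZSpan.fundamentalDomain B) ∩ (Λ : Set W)).Finite := by
      refine Metric.finite_isBounded_inter_isClosed DiscreteTopology.isDiscrete
        (ZSpan.fundamentalDomain_isBounded B) ?_
      rw [← Submodule.coe_toAddSubgroup]
      exact @AddSubgroup.isClosed_of_discrete _ _ _ _ _ Λ.toAddSubgroup dΛ
    have hmem : ∀ k : ℕ, ZSpan.fract B (k • π x) ∈ ((ZSpan.fundamentalDomain B) ∩ (Λ : Set W)) := by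
      intro k
      refine ⟨ZSpan.fract_mem_fundamentalDomain _ _, ?_⟩
      refine Λ.sub_mem (Λ.smul_of_tower_mem k ((hΛ _).mpr (hπG x hxG))) (hle ?_)
      exact hB.le (ZSpan.floor B _).2
    obtain ⟨k, -, l, -, hkl, he⟩ := Set.infinite_univ.exists_ne_map_eq_of_mapsTo
      (f := fun k : ℕ => ZSpan.fract B (k • π x)) (fun k _ => hmem k) hfin
    rw [ZSpan.fract_eq_fract, hB] at he
    refine ⟨l - k, by omega, ?_⟩
    convert he using 1
    rw [sub_smul]; simp [sub_eq_neg_add]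
  have hmemB : ∀ y : W, y ∈ Λ₀ ↔ ∀ i, ∃ k : ℤ, B.repr y i = k := by
    intro y
    have h1 : y ∈ Λ₀ ↔ y ∈ Submodule.span ℤ (Set.range B) := ⟨fun h => hB.ge h, fun h => hB.le h⟩
    rw [h1, Module.Basis.mem_span_iff_repr_mem]
    simp [eq_comm]
  have hx0 : π x ∈ Λ₀ := by
    rw [hmemB]
    intro j
    have hm : ∀ i, ∃ k : ℤ, B.repr (π (Pi.basisFun ℝ (Fin r) i)) j = k := fun i =>
      (hmemB _).mp ⟨_, Submodule.subset_span ⟨i, rfl⟩, rfl⟩ j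
    choose m hm using hm
    have hsum : B.repr (π x) j = ∑ i, (m i : ℝ) * x i := by
      conv_lhs => rw [← (Pi.basisFun ℝ (Fin r)).sum_repr x]
      simp only [map_sum, map_smul, Finsupp.coe_finsetSum, Finset.sum_apply, Finsupp.smul_apply, hm,
        smul_eq_mul, Pi.basisFun_repr]
      exact Finset.sum_congr rfl fun i _ => mul_comm _ _
    rw [hsum]
    apply hx
    obtain ⟨N, hN, hNx⟩ := hrat
    obtain ⟨k, hk⟩ := (hmemB _).mp hNx j
    refine ⟨N, hN, k, ?_⟩
    rw [← hk, ← hsum, ← Int.cast_smul_eq_zsmul ℝ, map_smul]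
    simp
  obtain ⟨p, hp, hpx⟩ := hx0
  have hpx' : π p = π x := hpx
  have hV : x - p ∈ linPart G := by
    rw [← Submodule.ker_projectionOnto hc.symm, LinearMap.mem_ker, map_sub]
    exact sub_eq_zero.mpr hpx'.symm
  refine ⟨x - p, ?_, p, aux_int_span.mp hp, by simp⟩
  have hconn : IsPreconnected (linPart G : Set (Fin r → ℝ)) := (linPart G).convex.isPreconnected
  exact hconn.subset_connectedComponentIn (linPart G).zero_mem (fun v hv => linPart_le G hv) hV

/-- Primitive multiples. -/
lemma aux_prim (M : Submodule ℤ ℝ) (hM : M.FG) (v : ℝ) (hv : 0 < v) (hvM : v ∈ M) :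
    ∃ n : ℕ, 0 < n ∧ v / n ∈ M ∧
      ∀ N k : ℤ, N ≠ 0 → ∀ y ∈ M, (N : ℝ) * y = k * (v / n) → ∃ l : ℤ, y = l * (v / n) := by
  have : Module.Finite ℤ M := .of_fg hM
  let b := Module.Free.chooseBasis ℤ M
  have hne : b.repr ⟨v, hvM⟩ ≠ 0 := by
    intro h
    rw [LinearEquiv.map_eq_zero_iff] at h
    exact hv.ne' (congrArg Subtype.val h)
  obtain ⟨i, hi⟩ := Finsupp.ne_iff.mp hne
  simp only [Finsupp.coe_zero, Pi.zero_apply] at hi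
  set c : ℤ := b.repr ⟨v, hvM⟩ i with hc
  let I : Ideal ℤ :=
    { carrier := {a | ∃ y ∈ M, (c : ℝ) * y = a * v}
      add_mem' := by
        rintro a a' ⟨y, hy, h⟩ ⟨y', hy', h'⟩
        exact ⟨y + y', M.add_mem hy hy', by push_cast; linarith⟩
      zero_mem' := ⟨0, M.zero_mem, by simp⟩
      smul_mem' := by
        rintro d a ⟨y, hy, h⟩
        refine ⟨d • y, M.smul_mem d hy, ?_⟩
        simp only [zsmul_eq_mul, smul_eq_mul, Int.cast_mul]
        linear_combination (d : ℝ) * h }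
  have hcI : c ∈ I := ⟨v, hvM, rfl⟩
  obtain ⟨g, hg⟩ := (IsPrincipalIdealRing.principal I).principal
  have hgI : g ∈ I := by rw [hg]; exact Submodule.mem_span_singleton_self g
  have hdiv : ∀ a ∈ I, ∃ l : ℤ, a = l * g := by
    intro a ha
    rw [hg] at ha
    obtain ⟨l, hl⟩ := Submodule.mem_span_singleton.mp ha
    exact ⟨l, hl.symm⟩
  obtain ⟨n, hn⟩ := hdiv c hcI
  obtain ⟨y0, hy0, hy0v⟩ := hgI
  have hg0 : (g : ℝ) ≠ 0 := by
    rintro h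
    have : g = 0 := by exact_mod_cast h
    simp [this] at hn; exact hi hn
  have hn0 : n ≠ 0 := by rintro rfl; simp at hn; exact hi hn
  have hn0' : (n : ℝ) ≠ 0 := by exact_mod_cast hn0
  have hci : (c : ℝ) ≠ 0 := by exact_mod_cast hi
  have hcng : (c : ℝ) = n * g := by exact_mod_cast hn
  have hny : y0 = v / n := by
    rw [eq_div_iff hn0']
    apply mul_left_cancel₀ hg0
    rw [hcng] at hy0v
    linarith
  have key : ∀ N k : ℤ, N ≠ 0 → ∀ y ∈ M, (N : ℝ) * y = k * v → ∃ l : ℤ, y = l * y0 := by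
    intro N k hN y hy h
    have e : N • (⟨y, hy⟩ : M) = k • (⟨v, hvM⟩ : M) := by
      ext1; simpa using h
    have e2 : N * b.repr ⟨y, hy⟩ i = k * c := by
      have := congrArg (fun z => b.repr z i) e
      simp only [map_smul, Finsupp.smul_apply, smul_eq_mul] at this
      exact this
    set a := b.repr ⟨y, hy⟩ i
    have hN' : (N : ℝ) ≠ 0 := by exact_mod_cast hN
    have e2' : (N : ℝ) * a = k * c := by exact_mod_cast e2
    have haI : a ∈ I := by
      refine ⟨y, hy, ?_⟩
      apply mul_left_cancel₀ hN'
      linear_combination (c : ℝ) * h - v * e2'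
    obtain ⟨l, hl⟩ := hdiv a haI
    have hl' : (a : ℝ) = l * g := by exact_mod_cast hl
    refine ⟨l, ?_⟩
    apply mul_left_cancel₀ (mul_ne_zero hN' hci)
    linear_combination (c : ℝ) * h - v * e2' + N * v * hl' - N * l * hy0v
  have habs : ∃ s : ℤ, s * s = 1 ∧ v / (n.natAbs : ℝ) = s * y0 := by
    rcases lt_or_gt_of_ne hn0 with h | h
    · refine ⟨-1, by norm_num, ?_⟩
      have : (n : ℝ) < 0 := by exact_mod_cast h
      rw [hny, Nat.cast_natAbs, Int.cast_abs, abs_of_neg this, div_neg]; simp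
    · refine ⟨1, by norm_num, ?_⟩
      have : 0 < (n : ℝ) := by exact_mod_cast h
      rw [hny, Nat.cast_natAbs, Int.cast_abs, abs_of_pos this]; simp
  obtain ⟨s, hs, hsv⟩ := habs
  have hs' : (s : ℝ) * s = 1 := by exact_mod_cast hs
  refine ⟨n.natAbs, Int.natAbs_pos.mpr hn0, ?_, ?_⟩
  · rw [hsv]; simpa using M.smul_mem s hy0
  · intro N k hN y hy h
    rw [hsv] at h ⊢
    obtain ⟨l, hl⟩ := key (N * n) (k * s) (mul_ne_zero hN hn0) y hy (by
      have : (n : ℝ) * y0 = v := by rw [hny]; field_simp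
      push_cast
      linear_combination (n : ℝ) * h + k * s * this)
    refine ⟨l * s, ?_⟩
    push_cast
    linear_combination hl - l * y0 * hs'

theorem exists_admissible_integer_multiple (r : ℕ) (u : Fin r → ℝ)
    (hu : ∀ i, 0 < u i) :
    ∃ q : Fin r → ℕ, (∀ i, 0 < q i) ∧ AdmissibleVec (fun i => (q i : ℝ) * u i) := by
  let M : Submodule ℤ ℝ := Submodule.span ℤ (Set.range fun i => (u i)⁻¹)
  have hM : M.FG := Submodule.fg_span (Set.finite_range _)
  have h := fun i => aux_prim M hM (u i)⁻¹ (inv_pos.mpr (hu i)) (Submodule.subset_span ⟨i, rfl⟩)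
  choose q hq hqM hprim using h
  refine ⟨q, hq, fun i => aux_main _ ?_⟩
  rintro m ⟨N, hN, k, hk⟩
  have hq' : ∀ i, (q i : ℝ) ≠ 0 := fun i => by exact_mod_cast (hq i).ne'
  have hu' : ∀ i, u i ≠ 0 := fun i => (hu i).ne'
  set y : ℝ := ∑ j, (m j : ℝ) * ((u j)⁻¹ / q j) with hy
  have hyM : y ∈ M := Submodule.sum_mem _ fun j _ => by
    have := M.smul_mem (m j) (hqM j)
    simpa using this
  have hs : ∑ j, (m j : ℝ) * (((q i : ℝ) * u i) • tildeVec fun i => (q i : ℝ) * u i) j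
      = (q i * u i) * y := by
    rw [hy, Finset.mul_sum]
    refine Finset.sum_congr rfl fun j _ => ?_
    have := hq' j
    have := hu' j
    simp only [tildeVec, Pi.smul_apply, smul_eq_mul]
    field_simp
  rw [hs] at hk ⊢
  have := hq' i
  have := hu' i
  obtain ⟨l, hl⟩ := hprim i N k hN y hyM (by rw [← hk]; field_simp)
  exact ⟨l, by rw [hl]; field_simp⟩
end
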